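/- arXiv:1706.04773 — 2 statements merged into one kernel-verified Lean document; each statement's English description precedes it below -/
import Mathlib

section
/- Let μ be a semifinite nonatomic Borel measure on a compactum X. Then for every Borel set B ⊆ X with B ∉ J₀(μ) there is a function φ : 2^ℕ → Bor(X) such that for every c ∈ 2^ℕ, φ(c) is a Borel subset of B with φ(c) ∉ J₀(μ), and φ(c) ∩ φ(d) = ∅ for all distinct c, d ∈ 2^ℕ. -/
open MeasureTheory Topology Filter Set ENNReal

/-- `J₀(μ)`: Borel sets coverable by countably many compact sets of `μ`-measure zero. -/
def Jzero {X : Type*} [TopologicalSpace X] [MeasurableSpace X] (μ : Measure X) :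
    Set (Set X) :=
  {A | MeasurableSet A ∧
    ∃ K : ℕ → Set X, (∀ n, IsCompact (K n) ∧ μ (K n) = 0) ∧ A ⊆ ⋃ n, K n}

/-- `μ` is semifinite: every Borel set of positive measure contains a Borel subset of
finite positive measure. -/
def Semifinite {X : Type*} [MeasurableSpace X] (μ : Measure X) : Prop :=
  ∀ A : Set X, MeasurableSet A → 0 < μ A →
    ∃ B ⊆ A, MeasurableSet B ∧ 0 < μ B ∧ μ B < ⊤

/-- A set covered by countably many compact null sets. -/
def CovNull {X : Type*} [TopologicalSpace X] [MeasurableSpace X] (μ : Measure X) (A : Set X) :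
    Prop :=
  ∃ S : Set (Set X), S.Countable ∧ (∀ K ∈ S, IsCompact K ∧ μ K = 0) ∧ A ⊆ ⋃₀ S

theorem CovNull.mono {X : Type*} [TopologicalSpace X] [MeasurableSpace X] {μ : Measure X}
    {A B : Set X} (h : CovNull μ B) (hAB : A ⊆ B) : CovNull μ A := by
  obtain ⟨S, h1, h2, h3⟩ := h
  exact ⟨S, h1, h2, hAB.trans h3⟩

theorem CovNull.sUnion {X : Type*} [TopologicalSpace X] [MeasurableSpace X] {μ : Measure X}
    {ι : Type*} {T : Set ι} (hT : T.Countable) {A : ι → Set X}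
    (h : ∀ i ∈ T, CovNull μ (A i)) : CovNull μ (⋃ i ∈ T, A i) := by
  choose! S h1 h2 h3 using h
  refine ⟨⋃ i ∈ T, S i, hT.biUnion h1, ?_, ?_⟩
  · intro K hK
    simp only [mem_iUnion] at hK
    obtain ⟨i, hi, hK⟩ := hK
    exact h2 i hi K hK
  · intro x hx
    simp only [mem_iUnion] at hx
    obtain ⟨i, hi, hx⟩ := hx
    obtain ⟨K, hK, hxK⟩ := h3 i hi hx
    exact ⟨K, mem_biUnion hi hK, hxK⟩

theorem CovNull.union {X : Type*} [TopologicalSpace X] [MeasurableSpace X] {μ : Measure X}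
    {A B : Set X} (hA : CovNull μ A) (hB : CovNull μ B) : CovNull μ (A ∪ B) := by
  obtain ⟨S, h1, h2, h3⟩ := hA
  obtain ⟨T, k1, k2, k3⟩ := hB
  refine ⟨S ∪ T, h1.union k1, ?_, ?_⟩
  · rintro K (hK | hK)
    exacts [h2 K hK, k2 K hK]
  · rw [sUnion_union]
    exact union_subset_union h3 k3

theorem CovNull.mem_Jzero {X : Type*} [TopologicalSpace X] [MeasurableSpace X] {μ : Measure X}
    {A : Set X} (hA : MeasurableSet A) (h : CovNull μ A) : A ∈ Jzero μ := by
  obtain ⟨S, h1, h2, h3⟩ := h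
  obtain ⟨K, hK⟩ := (h1.insert ∅).exists_eq_range (insert_nonempty _ _)
  refine ⟨hA, K, ?_, ?_⟩
  · intro n
    have : K n ∈ insert ∅ S := hK ▸ mem_range_self n
    rcases this with h | h
    · rw [h]; simp
    · exact h2 _ h
  · intro x hx
    obtain ⟨L, hL, hxL⟩ := h3 hx
    have : L ∈ range K := hK ▸ mem_insert_of_mem _ hL
    obtain ⟨n, rfl⟩ := this
    exact mem_iUnion.2 ⟨n, hxL⟩

/-- A sequence converging to `K` in a controlled way, with its even and odd parts
accumulating at each point of `K`. -/
theorem exists_nbhds {X : Type*} [MetricSpace X] [CompactSpace X]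
    (K Q : Set X) (hK : IsClosed K) (hne : K.Nonempty) (hQK : Disjoint Q K)
    (hKQ : K ⊆ closure Q) :
    ∃ (y : ℕ → X) (U : ℕ → Set X), (∀ n, y n ∈ Q) ∧ (∀ n, y n ∈ U n) ∧ (∀ n, IsOpen (U n)) ∧
      (Pairwise fun m n => Disjoint (U m) (U n)) ∧
      ∀ (b : Bool) (z : ℕ → X), (∀ k, z k ∈ U (Nat.bit b k)) → K ⊆ closure (range z) := by
  have : Nonempty X := ⟨hne.some⟩
  obtain ⟨D, hDK, hDc, hDd⟩ :=
    (TopologicalSpace.IsSeparable.of_separableSpace K).exists_countable_dense_subset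
  have hDne : D.Nonempty := by
    have := hne.mono hDd
    exact closure_nonempty_iff.1 this
  obtain ⟨d, hd⟩ := hDc.exists_eq_range hDne
  have hdK : ∀ j, d j ∈ K := fun j => hDK (hd ▸ mem_range_self j)
  let t : ℕ → X := fun n => d (Nat.unpair (Nat.div2 n)).1
  have htK : ∀ n, t n ∈ K := fun n => hdK _
  have step : ∀ (n : ℕ) (δ : ℝ), 0 < δ → ∃ y, y ∈ Q ∧ dist (t n) y < δ := by
    intro n δ hδ
    exact Metric.mem_closure_iff.1 (hKQ (htK n)) δ hδ
  choose! F hFQ hFd using step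
  let y : ℕ → X := fun n => Nat.rec (F 0 1)
    (fun n y => F (n+1) (min (Metric.infDist y K / 3) (1 / ((n : ℝ) + 2)))) n
  have hpos : ∀ x ∈ Q, 0 < Metric.infDist x K := by
    intro x hx
    exact (hK.notMem_iff_infDist_pos hne).1 (fun h => hQK.le_bot ⟨hx, h⟩)
  have hy0 : y 0 = F 0 1 := rfl
  have hys : ∀ n, y (n+1) = F (n+1) (min (Metric.infDist (y n) K / 3) (1 / ((n : ℝ) + 2))) :=
    fun n => rfl
  have hyQ : ∀ n, y n ∈ Q := by
    intro n
    induction n with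
    | zero => rw [hy0]; exact hFQ _ _ one_pos
    | succ n ih =>
      rw [hys]
      have := hpos _ ih
      exact hFQ _ _ (by positivity)
  have hyd : ∀ n, dist (t (n+1)) (y (n+1)) < min (Metric.infDist (y n) K / 3) (1 / ((n : ℝ) + 2)) := by
    intro n
    have := hpos _ (hyQ n)
    rw [hys]
    exact hFd _ _ (by positivity)
  have hyt : ∀ n, dist (t n) (y n) < 1 / ((n : ℝ) + 1) := by
    intro n
    cases n with
    | zero => rw [hy0]; simpa using hFd 0 1 one_pos
    | succ n =>
      have := (hyd n).trans_le (min_le_right _ _)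
      push_cast
      rw [add_assoc, one_add_one_eq_two]
      exact this
  let ρ : ℕ → ℝ := fun n => Metric.infDist (y n) K
  have hρpos : ∀ n, 0 < ρ n := fun n => hpos _ (hyQ n)
  have hρs : ∀ n, ρ (n+1) ≤ ρ n / 3 := by
    intro n
    have h1 := (hyd n).trans_le (min_le_left _ _)
    have h2 : ρ (n+1) ≤ dist (y (n+1)) (t (n+1)) := Metric.infDist_le_dist_of_mem (htK _)
    rw [dist_comm] at h2
    exact h2.trans h1.le
  have hanti : Antitone ρ := antitone_nat_of_succ_le (fun n => by
    have := hρs n; have := hρpos n; linarith)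
  have hρlt : ∀ m n, m < n → ρ n ≤ ρ m / 3 := fun m n h => (hanti h).trans (hρs m)
  have hcont : Continuous fun x : X => Metric.infDist x K := Metric.continuous_infDist_pt K
  let U : ℕ → Set X := fun n =>
    {x | ρ n / 2 < Metric.infDist x K} ∩ {x | Metric.infDist x K < 3 * ρ n / 2} ∩
      Metric.ball (y n) (1 / ((n : ℝ) + 1))
  refine ⟨y, U, hyQ, ?_, ?_, ?_, ?_⟩
  · intro n
    have := hρpos n
    refine ⟨⟨?_, ?_⟩, Metric.mem_ball_self (by positivity)⟩
    · change ρ n / 2 < ρ n; linarith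
    · change ρ n < 3 * ρ n / 2; linarith
  · intro n
    exact ((isOpen_lt continuous_const hcont).inter (isOpen_lt hcont continuous_const)).inter
      Metric.isOpen_ball
  · have key : ∀ m n, m < n → Disjoint (U m) (U n) := by
      intro m n hmn
      rw [Set.disjoint_left]
      rintro x ⟨⟨h1, -⟩, -⟩ ⟨⟨-, h2⟩, -⟩
      simp only [mem_ofPred_eq] at h1 h2
      have := hρlt m n hmn
      linarith
    intro m n hmn
    rcases lt_or_gt_of_ne hmn with h | h
    exacts [key _ _ h, (key _ _ h).symm]
  · intro b z hz
    refine hDd.trans (closure_minimal ?_ isClosed_closure)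
    rw [hd]
    rintro _ ⟨j, rfl⟩
    rw [Metric.mem_closure_iff]
    intro ε hε
    obtain ⟨m, hm⟩ := exists_nat_one_div_lt (half_pos hε)
    refine ⟨_, mem_range_self (Nat.pair j m), ?_⟩
    set N := Nat.bit b (Nat.pair j m) with hN
    have hNm : m ≤ N := by
      have h1 := Nat.right_le_pair j m
      have h2 : Nat.pair j m ≤ N := by rw [hN, Nat.bit_val]; omega
      omega
    have h1 : dist (z (Nat.pair j m)) (y N) < 1 / ((N : ℝ) + 1) := (hz (Nat.pair j m)).2
    have h2 := hyt N
    have h3 : t N = d j := by simp [t, hN, Nat.div2_bit]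
    rw [h3] at h2
    have h4 : 1 / ((N : ℝ) + 1) ≤ 1 / ((m : ℝ) + 1) := by
      apply one_div_le_one_div_of_le (by positivity)
      have : (m : ℝ) ≤ N := by exact_mod_cast hNm
      linarith
    have h5 := dist_triangle_right (d j) (z (Nat.pair j m)) (y N)
    linarith

theorem exists_children {X P : Type*} [MetricSpace X] [CompactSpace X] [MeasurableSpace X]
    [BorelSpace X] (μ : Measure X) (hμna : ∀ x : X, μ {x} = 0) (hμsemi : Semifinite μ)
    [MetricSpace P] (f : P → X) (hf : Continuous f)
    (V : Set P) (hV : IsOpen V) (hVc : ¬ CovNull μ (f '' V)) (ε : ℝ) (hε : 0 < ε) :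
    ∃ (W : ℕ → Set P), (∀ n, IsOpen (W n)) ∧ (∀ n, (W n).Nonempty) ∧
      (∀ n, closure (W n) ⊆ V) ∧ (∀ n, Metric.ediam (W n) ≤ ENNReal.ofReal ε) ∧
      (Pairwise fun m n => Disjoint (f '' W m) (f '' W n)) ∧
      ∀ (b : Bool) (z : ℕ → X), (∀ k, z k ∈ f '' W (Nat.bit b k)) →
        0 < μ (closure (range z)) := by
  have hpos : 0 < μ (closure (f '' V)) := by
    rw [pos_iff_ne_zero]
    intro h0
    exact hVc ⟨{closure (f '' V)}, countable_singleton _,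
      by simpa using ⟨isClosed_closure.isCompact, h0⟩, by
        rw [sUnion_singleton]; exact subset_closure⟩
  obtain ⟨A, hA, hAm, hA0, hAt⟩ := hμsemi _ isClosed_closure.measurableSet hpos
  obtain ⟨Q, hQV, hQc, hQd⟩ :=
    (TopologicalSpace.IsSeparable.of_separableSpace (f '' V)).exists_countable_dense_subset
  have : NullSingletonClass μ := ⟨hμna⟩
  have hQ0 : μ Q = 0 := hQc.measure_zero μ
  have : IsFiniteMeasure (μ.restrict A) := ⟨by simpa using hAt⟩
  have hAQ : 0 < (μ.restrict A) (A \ Q) := by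
    rw [Measure.restrict_apply (hAm.diff hQc.measurableSet),
      inter_eq_left.2 sdiff_subset, measure_sdiff_null hQ0]
    exact hA0
  obtain ⟨K, hKA, hKc, hK0⟩ :=
    (hAm.diff hQc.measurableSet).exists_lt_isClosed_of_ne_top (measure_ne_top _ _) hAQ
  have hK0' : 0 < μ K := hK0.trans_le (Measure.restrict_apply_le _ _)
  have hKne : K.Nonempty := nonempty_of_measure_ne_zero hK0'.ne'
  obtain ⟨y, U, hyQ, hyU, hUo, hUd, hUK⟩ := exists_nbhds K Q hKc hKne
    (Set.disjoint_left.2 fun x hx hxK => (hKA hxK).2 hx)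
    (fun x hx => (closure_minimal hQd isClosed_closure) (hA (hKA hx).1))
  choose x hxV hxy using fun n => hQV (hyQ n)
  have hball : ∀ n, ∃ r : ℝ, 0 < r ∧ Metric.closedBall (x n) r ⊆ V ∩ f ⁻¹' (U n) := by
    intro n
    have : V ∩ f ⁻¹' (U n) ∈ 𝓝 (x n) :=
      (hV.inter ((hUo n).preimage hf)).mem_nhds ⟨hxV n, by
        change f (x n) ∈ U n; rw [hxy]; exact hyU n⟩
    exact Metric.nhds_basis_closedBall.mem_iff.1 this
  choose r hr0 hr using hball
  have hWU : ∀ n, Metric.closedBall (x n) (min (r n) (ε / 2)) ⊆ V ∩ f ⁻¹' (U n) := fun n =>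
    (Metric.closedBall_subset_closedBall (min_le_left _ _)).trans (hr n)
  have hWf : ∀ n, f '' (Metric.ball (x n) (min (r n) (ε / 2))) ⊆ U n := by
    intro n
    rw [image_subset_iff]
    exact (Metric.ball_subset_closedBall.trans (hWU n)).trans inter_subset_right
  refine ⟨fun n => Metric.ball (x n) (min (r n) (ε / 2)), fun n => Metric.isOpen_ball, ?_, ?_, ?_,
    ?_, ?_⟩
  · intro n
    have := hr0 n
    exact ⟨x n, Metric.mem_ball_self (by positivity)⟩
  · intro n
    exact (Metric.closure_ball_subset_closedBall.trans (hWU n)).trans inter_subset_left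
  · intro n
    refine Metric.ediam_le fun a ha b hb => ?_
    rw [edist_dist]
    apply ENNReal.ofReal_le_ofReal
    have h1 : dist a (x n) < ε / 2 := lt_of_lt_of_le ha (min_le_right _ _)
    have h2 : dist b (x n) < ε / 2 := lt_of_lt_of_le hb (min_le_right _ _)
    have := dist_triangle_right a b (x n)
    linarith
  · intro m n hmn
    exact (hUd hmn).mono (hWf m) (hWf n)
  · intro b z hz
    exact hK0'.trans_le (measure_mono (hUK b z fun k => hWf _ (hz k)))

/-- The recursive scheme. -/
def schemeOf {P : Type*} (S : Set P → ℕ → ℕ → Set P) : List ℕ → Set P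
  | [] => univ
  | a :: l => S (schemeOf S l) l.length a

theorem core {X P : Type*} [MetricSpace X] [CompactSpace X] [MeasurableSpace X]
    [BorelSpace X] (μ : Measure X) (hμna : ∀ x : X, μ {x} = 0) (hμsemi : Semifinite μ)
    [MetricSpace P] [CompleteSpace P] [Nonempty P] (f : P → X) (hf : Continuous f)
    (H : ∀ V : Set P, IsOpen V → V.Nonempty → ¬ CovNull μ (f '' V)) :
    ∃ φ : (ℕ → Bool) → Set X,
        (∀ c : ℕ → Bool, φ c ⊆ range f ∧ MeasurableSet (φ c) ∧ φ c ∉ Jzero μ) ∧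
        ∀ c d : ℕ → Bool, c ≠ d → φ c ∩ φ d = ∅ := by
  have step := fun (V : Set P) (n : ℕ) (hV : IsOpen V ∧ V.Nonempty) =>
    exists_children μ hμna hμsemi f hf V hV.1 (H V hV.1 hV.2) (1 / ((n : ℝ) + 1)) (by positivity)
  choose! S hSo hSne hScl hSdiam hSdisj hSpos using step
  let A : List ℕ → Set P := schemeOf S
  have hA : ∀ l, IsOpen (A l) ∧ (A l).Nonempty := by
    intro l
    induction l with
    | nil => exact ⟨isOpen_univ, univ_nonempty⟩
    | cons a l ih => exact ⟨hSo _ _ ih a, hSne _ _ ih a⟩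
  have hcl : CantorScheme.ClosureAntitone A := fun l a => hScl _ _ (hA l) a
  have hvd : CantorScheme.VanishingDiam A := by
    intro x
    rw [← tendsto_add_atTop_iff_nat 1]
    have h0 : Tendsto (fun n : ℕ => ENNReal.ofReal (1 / ((n : ℝ) + 1))) atTop (𝓝 0) := by
      have := ENNReal.tendsto_ofReal (tendsto_one_div_add_atTop_nhds_zero_nat (𝕜 := ℝ))
      simpa using this
    refine tendsto_of_tendsto_of_tendsto_of_le_of_le tendsto_const_nhds h0 (fun _ => bot_le) ?_
    intro n
    have := hSdiam _ (PiNat.res x n).length (hA (PiNat.res x n)) (x n)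
    refine le_trans (le_of_eq rfl) (this.trans (le_of_eq ?_))
    rw [PiNat.res_length]
  have huniv := hcl.map_of_vanishingDiam hvd (fun l => (hA l).2)
  let g : (ℕ → ℕ) → X := fun α =>
    f ((CantorScheme.inducedMap A).2 ⟨α, by rw [huniv]; trivial⟩)
  have hgc : Continuous g :=
    hf.comp (hvd.map_continuous.comp (continuous_id.subtype_mk _))
  have hgm : ∀ α n, g α ∈ f '' A (PiNat.res α n) := fun α n =>
    mem_image_of_mem f (CantorScheme.map_mem (A := A) ⟨α, by rw [huniv]; trivial⟩ n)
  have hginj : Function.Injective g := by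
    intro α β h
    apply PiNat.res_injective
    ext n : 1
    induction n with
    | zero => simp
    | succ n ih =>
      simp only [PiNat.res_succ, List.cons.injEq]
      refine ⟨?_, ih⟩
      by_contra hne
      have h1 := hgm α (n+1)
      have h2 := hgm β (n+1)
      rw [← h, PiNat.res_succ, ← ih] at h2
      exact (hSdisj _ (PiNat.res α n).length (hA (PiNat.res α n)) hne).le_bot ⟨h1, h2⟩
  let e : (ℕ → Bool) → (ℕ → ℕ) → (ℕ → ℕ) := fun c β n => Nat.bit (c n) (β n)
  have hec : ∀ c, Continuous (e c) := fun c => continuous_pi fun n =>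
    (continuous_of_discreteTopology (f := fun k : ℕ => Nat.bit (c n) k)).comp (continuous_apply n)
  have hbit : ∀ c d β γ, e c β = e d γ → c = d ∧ β = γ := by
    intro c d β γ h
    have h' : ∀ n, c n = d n ∧ β n = γ n := by
      intro n
      have hn : Nat.bit (c n) (β n) = Nat.bit (d n) (γ n) := congrFun h n
      constructor
      · simpa using congrArg Nat.bodd hn
      · simpa [Nat.div2_bit] using congrArg Nat.div2 hn
    exact ⟨funext fun n => (h' n).1, funext fun n => (h' n).2⟩
  refine ⟨fun c => range (g ∘ e c), fun c => ⟨?_, ?_, ?_⟩, ?_⟩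
  · rintro _ ⟨β, rfl⟩
    exact mem_range_self _
  · exact measurableSet_range_of_continuous_injective (hgc.comp (hec c))
      (hginj.comp fun β γ h => (hbit _ _ _ _ h).2)
  · rintro ⟨-, K, hK, hcov⟩
    have hclosed : ∀ n, IsClosed ((g ∘ e c) ⁻¹' K n) := fun n =>
      (hK n).1.isClosed.preimage (hgc.comp (hec c))
    have hU : ⋃ n, (g ∘ e c) ⁻¹' K n = univ := by
      rw [← preimage_iUnion, eq_univ_iff_forall]
      exact fun β => hcov (mem_range_self β)
    obtain ⟨n, β, hβ⟩ := nonempty_interior_of_iUnion_of_closed hclosed hU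
    obtain ⟨_, ⟨γ, m, rfl⟩, hγ, hsub⟩ :=
      (PiNat.isTopologicalBasis_cylinders (fun _ : ℕ => ℕ)).exists_subset_of_mem_open
        hβ isOpen_interior
    let δ : ℕ → (ℕ → ℕ) := fun k => Function.update γ m k
    have hδ : ∀ k, δ k ∈ PiNat.cylinder γ m := by
      intro k i hi
      exact Function.update_of_ne hi.ne _ _
    have hres : ∀ k, PiNat.res (e c (δ k)) m = PiNat.res (e c γ) m := by
      intro k
      rw [PiNat.res_eq_res]
      intro i hi
      change Nat.bit _ (δ k i) = Nat.bit _ (γ i)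
      rw [hδ k i hi]
    have hpos := hSpos _ (PiNat.res (e c γ) m).length (hA (PiNat.res (e c γ) m)) (c m)
      (fun k => g (e c (δ k))) (by
        intro k
        have h1 := hgm (e c (δ k)) (m+1)
        rw [PiNat.res_succ, hres k] at h1
        have h2 : e c (δ k) m = Nat.bit (c m) k := by simp [e, δ]
        rw [h2] at h1
        exact h1)
    have hle : closure (range fun k => g (e c (δ k))) ⊆ K n := by
      apply closure_minimal _ (hK n).1.isClosed
      rintro _ ⟨k, rfl⟩
      have hk : δ k ∈ (g ∘ e c) ⁻¹' K n := interior_subset (hsub (hδ k))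
      exact hk
    exact (hpos.trans_le (measure_mono hle)).ne' (hK n).2
  · intro c d hcd
    rw [eq_empty_iff_forall_notMem]
    rintro _ ⟨⟨β, rfl⟩, ⟨γ, hγ⟩⟩
    exact hcd (hbit _ _ _ _ (hginj hγ)).1.symm

/-- Proposition 6.8(ii): for a semifinite nonatomic Borel measure `μ`, below every Borel
set `B ∉ J₀(μ)` there is a family, indexed by the Cantor space, of pairwise disjoint
Borel subsets of `B` not in `J₀(μ)`. -/
theorem statement16 {X : Type*}
    [MetricSpace X] [CompactSpace X] [Nonempty X] [MeasurableSpace X] [BorelSpace X]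
    (μ : Measure X) (hμna : ∀ x : X, μ {x} = 0) (hμsemi : Semifinite μ) :
    ∀ B : Set X, MeasurableSet B → B ∉ Jzero μ →
      ∃ φ : (ℕ → Bool) → Set X,
        (∀ c : ℕ → Bool, φ c ⊆ B ∧ MeasurableSet (φ c) ∧ φ c ∉ Jzero μ) ∧
        ∀ c d : ℕ → Bool, c ≠ d → φ c ∩ φ d = ∅ := by
  intro B hB hBJ
  have hBc : ¬ CovNull μ B := fun h => hBJ (h.mem_Jzero hB)
  have hBan : AnalyticSet B := hB.analyticSet
  rw [AnalyticSet] at hBan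
  rcases hBan with rfl | ⟨f, hf, rfl⟩
  · exact absurd ⟨∅, countable_empty, by simp, by simp⟩ hBc
  let b := TopologicalSpace.countableBasis (ℕ → ℕ)
  let T : Set (Set (ℕ → ℕ)) := {s ∈ b | CovNull μ (f '' s)}
  have hTc : T.Countable := (TopologicalSpace.countable_countableBasis _).mono (sep_subset _ _)
  have hbb := TopologicalSpace.isBasis_countableBasis (ℕ → ℕ)
  let U : Set (ℕ → ℕ) := ⋃₀ T
  have hUo : IsOpen U := isOpen_sUnion fun s hs => hbb.isOpen hs.1
  have hUc : CovNull μ (f '' U) := by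
    have : f '' U = ⋃ s ∈ T, f '' s := by
      simp only [U, sUnion_eq_biUnion, image_iUnion]
    rw [this]
    exact CovNull.sUnion hTc fun s hs => hs.2
  have hC : IsClosed Uᶜ := hUo.isClosed_compl
  have : PolishSpace ↥(Uᶜ) := hC.polishSpace
  let := TopologicalSpace.upgradeIsCompletelyMetrizable ↥(Uᶜ)
  have hne : Nonempty ↥(Uᶜ) := by
    rw [nonempty_subtype]
    by_contra hcon
    push Not at hcon
    have hU : U = univ := eq_univ_iff_forall.2 fun x => by simpa using hcon x
    rw [hU, image_univ] at hUc
    exact hBc hUc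
  obtain ⟨φ, h1, h2⟩ := core μ hμna hμsemi (fun x : ↥(Uᶜ) => f x)
    (hf.comp continuous_subtype_val) (by
      rintro V hV ⟨x, hx⟩ hcov
      obtain ⟨V', hV', rfl⟩ := isOpen_induced_iff.1 hV
      obtain ⟨s, hs, hxs, hsV⟩ := hbb.exists_subset_of_mem_open hx hV'
      have hsc : CovNull μ (f '' s) := by
        refine (hcov.union hUc).mono ?_
        rintro _ ⟨y, hy, rfl⟩
        by_cases hyU : y ∈ U
        · exact Or.inr ⟨y, hyU, rfl⟩
        · exact Or.inl ⟨⟨y, hyU⟩, hsV hy, rfl⟩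
      exact x.2 ⟨s, ⟨hs, hsc⟩, hxs⟩)
  refine ⟨φ, fun c => ⟨(h1 c).1.trans ?_, (h1 c).2⟩, h2⟩
  rintro _ ⟨x, rfl⟩
  exact mem_range_self _
end

section
/- Let I be a calibrated σ-ideal on a compactum X. Whenever f : B → ℕ^ℕ is a Borel-measurable map on a Borel set B ⊆ X with B ∉ I such that f⁻¹({y}) ∈ I for every y ∈ ℕ^ℕ, there exists a Borel set C ⊆ B with C ∉ I such that the restriction of f to C is injective. -/
open MeasureTheory Topology Filter Set

/-- A σ-ideal of Borel sets: closed under Borel subsets and countable unions. -/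
def SigmaIdeal {X : Type*} [TopologicalSpace X] [MeasurableSpace X]
    (I : Set (Set X)) : Prop :=
  (∀ A ∈ I, MeasurableSet A) ∧
  (∀ A ∈ I, ∀ B : Set X, MeasurableSet B → B ⊆ A → B ∈ I) ∧
  (∀ A : ℕ → Set X, (∀ n, A n ∈ I) → (⋃ n, A n) ∈ I)

/-- `I` is generated by compact sets. -/
def GenByCompacts {X : Type*} [TopologicalSpace X] (I : Set (Set X)) : Prop :=
  ∀ A ∈ I, ∃ S : ℕ → Set X, (∀ n, IsCompact (S n)) ∧ (⋃ n, S n) ∈ I ∧ A ⊆ ⋃ n, S n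

/-- A calibrated σ-ideal. -/
def Calibrated {X : Type*} [TopologicalSpace X] [MeasurableSpace X]
    (I : Set (Set X)) : Prop :=
  SigmaIdeal I ∧ GenByCompacts I ∧
    ∀ K : Set X, IsCompact K → K ∉ I →
      ∀ Kn : ℕ → Set X, (∀ n, IsCompact (Kn n) ∧ Kn n ∈ I) →
        ∃ L : Set X, IsCompact L ∧ L ⊆ K \ (⋃ n, Kn n) ∧ L ∉ I


/-- `A` is covered by countably many compact members of `I`. -/
def JCov {X : Type*} [TopologicalSpace X] (I : Set (Set X)) (A : Set X) : Prop :=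
  ∃ S : ℕ → Set X, (∀ n, IsCompact (S n) ∧ S n ∈ I) ∧ A ⊆ ⋃ n, S n

section helpers

variable {X : Type*} [MetricSpace X] [CompactSpace X] [MeasurableSpace X] [BorelSpace X]
  {I : Set (Set X)}

lemma JCov.mono {A A' : Set X} (h : JCov I A) (hs : A' ⊆ A) : JCov I A' := by
  obtain ⟨S, h1, h2⟩ := h
  exact ⟨S, h1, hs.trans h2⟩

lemma JCov.iUnion {A : ℕ → Set X} (h : ∀ n, JCov I (A n)) : JCov I (⋃ n, A n) := by
  choose S h1 h2 using h
  refine ⟨fun k => S k.unpair.1 k.unpair.2, fun k => h1 _ _, ?_⟩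
  intro x hx
  obtain ⟨n, hn⟩ := mem_iUnion.1 hx
  obtain ⟨m, hm⟩ := mem_iUnion.1 (h2 n hn)
  exact mem_iUnion.2 ⟨Nat.pair n m, by simpa using hm⟩

lemma JCov.union {A A' : Set X} (h : JCov I A) (h' : JCov I A') : JCov I (A ∪ A') := by
  have : JCov I (⋃ n : ℕ, if n = 0 then A else A') := by
    apply JCov.iUnion
    intro n
    split_ifs <;> assumption
  refine this.mono ?_
  rintro x (hx | hx)
  · exact mem_iUnion.2 ⟨0, by simpa using hx⟩
  · exact mem_iUnion.2 ⟨1, by simpa using hx⟩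

lemma JCov.mem (hI : Calibrated I) {A : Set X} (h : JCov I A) (hA : MeasurableSet A) : A ∈ I := by
  obtain ⟨S, h1, h2⟩ := h
  exact hI.1.2.1 _ (hI.1.2.2 S fun n => (h1 n).2) A hA h2

lemma JCov.of_mem (hI : Calibrated I) {A : Set X} (h : A ∈ I) : JCov I A := by
  obtain ⟨S, h1, h2, h3⟩ := hI.2.1 A h
  exact ⟨S, fun n => ⟨h1 n, hI.1.2.1 _ h2 _ (h1 n).measurableSet (subset_iUnion S n)⟩, h3⟩

variable {P Z : Type*} [MetricSpace P] [SecondCountableTopology P]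
  [MetricSpace Z] [CompactSpace Z]

lemma key_claim (hI : Calibrated I) (h0 : ∅ ∈ I) {φ : P → X} {g : P → Z}
    (hφ : Continuous φ) (hg : Continuous g)
    (hpos : ∀ V : Set P, IsOpen V → V.Nonempty → ¬ JCov I (φ '' V))
    (hfib : ∀ z, JCov I (φ '' (g ⁻¹' {z})))
    (U : Set P) (hU : IsOpen U) (hUne : U.Nonempty) :
    ∃ L : Set X, IsCompact L ∧ L ∉ I ∧ ∃ h : Z → ℝ, Continuous h ∧
      ∀ l ∈ L, ∀ ε > 0, ∃ u ∈ U, dist (φ u) l < ε ∧ 0 < h (g u) ∧ h (g u) < ε := by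
  have : Nonempty P := ⟨hUne.some⟩
  set E : Set (X × Z) := closure ((fun u => (φ u, g u)) '' U) with hE
  have hEc : IsCompact E := isClosed_closure.isCompact
  have hsec : ∀ z, IsCompact {x | (x, z) ∈ E} := fun z =>
    (isClosed_closure.preimage (by fun_prop : Continuous fun x : X => (x, z))).isCompact
  -- it suffices to find `L` and `M`
  suffices H : ∃ L : Set X, IsCompact L ∧ L ∉ I ∧ ∃ M : Set Z, IsCompact M ∧
      (∀ l ∈ L, ∃ z ∈ M, (l, z) ∈ E) ∧
      (∀ V : Set P, IsOpen V → V.Nonempty → ∃ v ∈ V, g v ∉ M) by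
    obtain ⟨L, hL, hLI, M, hM, hLM, hd⟩ := H
    refine ⟨L, hL, hLI, fun z => Metric.infDist z M, Metric.continuous_infDist_pt M, ?_⟩
    intro l hl ε hε
    obtain ⟨z, hz, hlz⟩ := hLM l hl
    obtain ⟨_, ⟨u, hu, rfl⟩, hdu⟩ := Metric.mem_closure_iff.1 hlz ε hε
    have ho : IsOpen (U ∩ ({v | dist (φ v) l < ε} ∩ {v | dist (g v) z < ε})) :=
      hU.inter ((isOpen_lt (by fun_prop) (by fun_prop)).inter
        (isOpen_lt (by fun_prop) (by fun_prop)))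
    rw [Prod.dist_eq, max_lt_iff] at hdu
    obtain ⟨v, ⟨hvU, hv1, hv2⟩, hvM⟩ := hd _ ho ⟨u, hu, by
      simpa [dist_comm] using hdu.1, by simpa [dist_comm] using hdu.2⟩
    exact ⟨v, hvU, hv1, (hM.isClosed.notMem_iff_infDist_pos ⟨z, hz⟩).1 hvM,
      (Metric.infDist_le_dist_of_mem hz).trans_lt hv2⟩
  by_cases hc : ∀ n, {x | (x, g (TopologicalSpace.denseSeq P n)) ∈ E} ∈ I
  · have hK : closure (φ '' U) ∉ I := fun hk => hpos U hU hUne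
      ⟨fun _ => closure (φ '' U), fun _ => ⟨isClosed_closure.isCompact, hk⟩,
        subset_closure.trans (subset_iUnion (fun _ : ℕ => closure (φ '' U)) 0)⟩
    obtain ⟨L, hL, hLK, hLI⟩ := hI.2.2 _ isClosed_closure.isCompact hK _
      (fun n => ⟨hsec (g (TopologicalSpace.denseSeq P n)), hc n⟩)
    refine ⟨L, hL, hLI, Prod.snd '' (E ∩ Prod.fst ⁻¹' L),
      (hEc.inter_right (hL.isClosed.preimage continuous_fst)).image continuous_snd, ?_, ?_⟩
    · intro l hl
      have hsub : closure (φ '' U) ⊆ Prod.fst '' E := by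
        apply closure_minimal _ (hEc.image continuous_fst).isClosed
        rintro _ ⟨u, hu, rfl⟩
        exact ⟨(φ u, g u), subset_closure ⟨u, hu, rfl⟩, rfl⟩
      obtain ⟨⟨l', z⟩, hlE, rfl⟩ := hsub (hLK hl).1
      exact ⟨z, ⟨(l', z), ⟨hlE, hl⟩, rfl⟩, hlE⟩
    · intro V hV hVne
      obtain ⟨v, hvV, n, rfl⟩ := (TopologicalSpace.denseRange_denseSeq P).inter_open_nonempty V hV hVne
      refine ⟨_, hvV, ?_⟩
      rintro ⟨⟨x, z⟩, ⟨hxE, hxL⟩, hz⟩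
      apply (hLK hxL).2
      simp only at hz
      subst hz
      exact mem_iUnion.2 ⟨n, hxE⟩
  · push Not at hc
    obtain ⟨n, hn⟩ := hc
    refine ⟨_, hsec _, hn, {g (TopologicalSpace.denseSeq P n)}, isCompact_singleton,
      fun l hl => ⟨_, rfl, hl⟩, ?_⟩
    intro V hV hVne
    by_contra hcon
    push Not at hcon
    exact hpos V hV hVne ((hfib _).mono (image_mono fun v hv => hcon v hv))

lemma key_step (hI : Calibrated I) (h0 : ∅ ∈ I) {φ : P → X} {g : P → Z}
    (hφ : Continuous φ) (hg : Continuous g)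
    (hpos : ∀ V : Set P, IsOpen V → V.Nonempty → ¬ JCov I (φ '' V))
    (hfib : ∀ z, JCov I (φ '' (g ⁻¹' {z})))
    (U : Set P) (hU : IsOpen U) (hUne : U.Nonempty) (δ : ℝ) (hδ : 0 < δ) :
    ∃ V : ℕ → Set P, (∀ i, IsOpen (V i) ∧ (V i).Nonempty) ∧ (∀ i, closure (V i) ⊆ U) ∧
      (∀ i, ∀ p ∈ V i, ∀ q ∈ V i, dist p q ≤ δ) ∧
      (∀ i j, ∀ p ∈ V i, ∀ q ∈ V j, g p = g q → i = j) ∧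
      ∃ K : Set X, K ∉ I ∧ IsCompact K ∧ ∀ x ∈ K, ∀ ε > 0, ∃ i, φ '' V i ⊆ Metric.ball x ε := by
  obtain ⟨L, hL, hLI, h, hh, hLh⟩ := key_claim hI h0 hφ hg hpos hfib U hU hUne
  have hLne : L.Nonempty := by
    rw [nonempty_iff_ne_empty]
    rintro rfl
    exact hLI h0
  have : Nonempty L := hLne.to_subtype
  let l : ℕ → L := TopologicalSpace.denseSeq L
  -- the sequence of points
  have hex : ∀ (i : ℕ) (c : ℝ), 0 < c → ∃ u ∈ U, dist (φ u) (l i.unpair.1) < 1 / ((i : ℝ) + 1) ∧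
      0 < h (g u) ∧ h (g u) < c := by
    intro i c hc
    obtain ⟨u, hu, h1, h2, h3⟩ := hLh (l i.unpair.1) (l i.unpair.1).2
      (min (1 / ((i : ℝ) + 1)) c) (lt_min (by positivity) hc)
    exact ⟨u, hu, h1.trans_le (min_le_left _ _), h2, h3.trans_le (min_le_right _ _)⟩
  have hseq : ∃ u : ℕ → P, (∀ i, u i ∈ U ∧ dist (φ (u i)) (l i.unpair.1) < 1 / ((i : ℝ) + 1) ∧
      0 < h (g (u i))) ∧ ∀ i, h (g (u (i + 1))) < h (g (u i)) / 4 := by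
    let T := {u : P // u ∈ U ∧ 0 < h (g u)}
    have hstep : ∀ (i : ℕ) (t : T), ∃ u : T, dist (φ u.1) (l i.unpair.1) < 1 / ((i : ℝ) + 1) ∧
        h (g u.1) < h (g t.1) / 4 := by
      intro i t
      obtain ⟨u, hu, h1, h2, h3⟩ := hex i (h (g t.1) / 4) (by linarith [t.2.2])
      exact ⟨⟨u, hu, h2⟩, h1, h3⟩
    choose F hF1 hF2 using hstep
    obtain ⟨u0, hu0, h01, h02, -⟩ := hex 0 1 one_pos
    let w : ℕ → T := fun n => Nat.rec ⟨u0, hu0, h02⟩ (fun k t => F (k + 1) t) n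
    refine ⟨fun n => (w n).1, fun i => ⟨(w i).2.1, ?_, (w i).2.2⟩, fun i => hF2 (i + 1) (w i)⟩
    cases i with
    | zero => exact h01
    | succ k => exact hF1 (k + 1) (w k)
  obtain ⟨u, hu, hu4⟩ := hseq
  have hu4' : ∀ i j, i < j → h (g (u j)) < h (g (u i)) / 4 := by
    intro i j hij
    induction j, hij using Nat.le_induction with
    | base => exact hu4 i
    | succ j hj ih => linarith [hu4 j, (hu j).2.2]
  have hr : ∀ i, ∃ r > 0, Metric.closedBall (u i) r ⊆ U ∩ ({p | dist (φ p) (φ (u i)) < 1 / ((i : ℝ) + 1)}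
      ∩ ({p | h (g (u i)) / 2 < h (g p)} ∩ {p | h (g p) < 2 * h (g (u i))})) ∧ r ≤ δ / 2 := by
    intro i
    have ho : IsOpen (U ∩ ({p | dist (φ p) (φ (u i)) < 1 / ((i : ℝ) + 1)}
      ∩ ({p | h (g (u i)) / 2 < h (g p)} ∩ {p | h (g p) < 2 * h (g (u i))}))) :=
      hU.inter ((isOpen_lt (by fun_prop) (by fun_prop)).inter
        ((isOpen_lt (by fun_prop) (by fun_prop)).inter (isOpen_lt (by fun_prop) (by fun_prop))))
    have hm : u i ∈ (U ∩ ({p | dist (φ p) (φ (u i)) < 1 / ((i : ℝ) + 1)}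
      ∩ ({p | h (g (u i)) / 2 < h (g p)} ∩ {p | h (g p) < 2 * h (g (u i))}))) := by
      have := (hu i).2.2
      refine ⟨(hu i).1, ?_, ?_, ?_⟩
      · simp only [mem_setOf_eq, dist_self]; positivity
      · simp only [mem_setOf_eq]; linarith
      · simp only [mem_setOf_eq]; linarith
    obtain ⟨r, hr, hrs⟩ := Metric.nhds_basis_closedBall.mem_iff.1 (ho.mem_nhds hm)
    exact ⟨min r (δ / 2), lt_min hr (by linarith),
      (Metric.closedBall_subset_closedBall (min_le_left _ _)).trans hrs, min_le_right _ _⟩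
  choose r hr0 hrs hrδ using hr
  have hbs : ∀ i p, p ∈ Metric.ball (u i) (r i) → p ∈ Metric.closedBall (u i) (r i) :=
    fun i p hp => Metric.ball_subset_closedBall hp
  have key : ∀ i j, i < j → ∀ p ∈ Metric.ball (u i) (r i), ∀ q ∈ Metric.ball (u j) (r j),
      g p ≠ g q := by
    intro i j hij p hp q hq hpq
    have a1 := (hrs i (hbs i p hp)).2.2.1
    have a2 := (hrs j (hbs j q hq)).2.2.2
    simp only [mem_setOf_eq] at a1 a2
    rw [hpq] at a1
    linarith [hu4' i j hij]
  refine ⟨fun i => Metric.ball (u i) (r i), fun i => ⟨Metric.isOpen_ball, u i,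
    Metric.mem_ball_self (hr0 i)⟩, fun i => Metric.closure_ball_subset_closedBall.trans
      ((hrs i).trans inter_subset_left), ?_, ?_, L, hLI, hL, ?_⟩
  · intro i p hp q hq
    have := dist_triangle_right p q (u i)
    rw [Metric.mem_ball] at hp hq
    linarith [hrδ i]
  · intro i j p hp q hq hpq
    rcases lt_trichotomy i j with hij | hij | hij
    · exact absurd hpq (key i j hij p hp q hq)
    · exact hij
    · exact absurd hpq.symm (key j i hij q hq p hp)
  · intro x hx ε hε
    obtain ⟨k, hk⟩ := Metric.denseRange_iff.1 (TopologicalSpace.denseRange_denseSeq L) ⟨x, hx⟩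
      (ε / 3) (by linarith)
    obtain ⟨m, hm⟩ := exists_nat_one_div_lt (show 0 < ε / 3 by linarith)
    refine ⟨Nat.pair k m, ?_⟩
    rintro _ ⟨p, hp, rfl⟩
    have a1 := (hrs _ (hbs _ p hp)).2.1
    have a2 := (hu (Nat.pair k m)).2.1
    simp only [mem_setOf_eq, Nat.unpair_pair] at a1 a2
    have a3 : 1 / ((Nat.pair k m : ℝ) + 1) ≤ 1 / ((m : ℝ) + 1) := by
      have : (m : ℝ) ≤ (Nat.pair k m : ℝ) := by exact_mod_cast Nat.right_le_pair k m
      gcongr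
    have a4 : dist x (l k : X) < ε / 3 := hk
    rw [Metric.mem_ball]
    have t1 := dist_triangle (φ p) (φ (u (Nat.pair k m))) x
    have t2 := dist_triangle_right (φ (u (Nat.pair k m))) x (l k : X)
    linarith

lemma core_s19 [CompleteSpace P] [Nonempty P] (hI : Calibrated I) (h0 : ∅ ∈ I) {φ : P → X} {g : P → Z}
    (hφ : Continuous φ) (hg : Continuous g)
    (hpos : ∀ V : Set P, IsOpen V → V.Nonempty → ¬ JCov I (φ '' V))
    (hfib : ∀ z, JCov I (φ '' (g ⁻¹' {z}))) :
    ∃ H : Set P, IsGδ H ∧ InjOn g H ∧ ¬ JCov I (φ '' H) := by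
  let O := {U : Set P // IsOpen U ∧ U.Nonempty}
  have hstep : ∀ (U : O) (n : ℕ), ∃ V : ℕ → O, (∀ i, closure (V i).1 ⊆ U.1) ∧
      (∀ i, ∀ p ∈ (V i).1, ∀ q ∈ (V i).1, dist p q ≤ 1 / ((n : ℝ) + 1)) ∧
      (∀ i j, ∀ p ∈ (V i).1, ∀ q ∈ (V j).1, g p = g q → i = j) ∧
      ∃ K : Set X, K ∉ I ∧ IsCompact K ∧
        ∀ x ∈ K, ∀ ε > 0, ∃ i, φ '' (V i).1 ⊆ Metric.ball x ε := by
    intro U n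
    obtain ⟨V, h1, h2⟩ := key_step hI h0 hφ hg hpos hfib U.1 U.2.1 U.2.2 (1 / ((n : ℝ) + 1))
      (by positivity)
    exact ⟨fun i => ⟨V i, h1 i⟩, h2⟩
  choose c hc1 hc2 hc3 hc4 using hstep
  let S : List ℕ → O := fun s => List.rec ⟨univ, isOpen_univ, univ_nonempty⟩
    (fun i s U => c U s.length i) s
  have hS : ∀ i s, S (i :: s) = c (S s) s.length i := fun i s => rfl
  have hsub : ∀ i s, (S (i :: s)).1 ⊆ (S s).1 := fun i s => subset_closure.trans (hc1 _ _ i)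
  refine ⟨⋂ n : ℕ, ⋃ s ∈ {s : List ℕ | s.length = n}, (S s).1,
    IsGδ.iInter_of_isOpen fun n => isOpen_biUnion fun s _ => (S s).2.1, ?_, ?_⟩
  · intro p hp q hq hpq
    have huniq : ∀ s s' : List ℕ, s.length = s'.length → p ∈ (S s).1 → q ∈ (S s').1 → s = s' := by
      intro s
      induction s with
      | nil =>
        intro s' hl _ _
        exact (List.length_eq_zero_iff.1 hl.symm).symm
      | cons i s ih =>
        intro s' hl hps hqs
        cases s' with
        | nil => simp at hl
        | cons j s' =>
          have hl' : s.length = s'.length := by simpa using hl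
          have e := ih s' hl' (hsub i s hps) (hsub j s' hqs)
          subst e
          rw [hc3 (S s) s.length i j p hps q hqs hpq]
    refine dist_le_zero.1 (le_of_forall_pos_le_add fun ε hε => ?_)
    obtain ⟨n, hn⟩ := exists_nat_one_div_lt hε
    have hp' := mem_iInter.1 hp (n + 1)
    have hq' := mem_iInter.1 hq (n + 1)
    simp only [mem_iUnion, mem_setOf_eq, exists_prop] at hp' hq'
    obtain ⟨s, hs, hps⟩ := hp'
    obtain ⟨s', hs', hqs⟩ := hq'
    have e := huniq s s' (hs.trans hs'.symm) hps hqs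
    subst e
    cases s with
    | nil => simp at hs
    | cons i s =>
      have hs2 : s.length = n := by simpa using hs
      have := hc2 (S s) s.length i p hps q hqs
      rw [hs2] at this
      linarith
  · rintro ⟨F, hF, hcov⟩
    have hnext : ∀ s : List ℕ, ∃ i, ∀ p ∈ (S (i :: s)).1, φ p ∉ F s.length := by
      intro s
      obtain ⟨K, hKI, hK, hKa⟩ := hc4 (S s) s.length
      have : ¬ K ⊆ F s.length := fun hKF =>
        hKI (hI.1.2.1 _ (hF s.length).2 K hK.measurableSet hKF)
      obtain ⟨x, hxK, hxF⟩ := not_subset.1 this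
      obtain ⟨ε, hε, hb⟩ := Metric.isOpen_iff.1 (hF s.length).1.isClosed.isOpen_compl x hxF
      obtain ⟨i, hi⟩ := hKa x hxK ε hε
      exact ⟨i, fun p hp => hb (hi ⟨p, hp, rfl⟩)⟩
    choose ν hν using hnext
    let b : ℕ → List ℕ := fun n => Nat.rec [] (fun _ s => ν s :: s) n
    have hb : ∀ n, b (n + 1) = ν (b n) :: b n := fun n => rfl
    have hbl : ∀ n, (b n).length = n := by
      intro n
      induction n with
      | zero => rfl
      | succ n ih => rw [hb, List.length_cons, ih]
    have hanti : Antitone fun n => (S (b n)).1 :=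
      antitone_nat_of_succ_le fun n => hsub _ _
    choose p hp using fun n => (S (b n)).2.2
    have hcau : CauchySeq fun n => p (n + 1) := by
      refine cauchySeq_of_le_tendsto_0 (fun n : ℕ => 1 / ((n : ℝ) + 1)) ?_
        tendsto_one_div_add_atTop_nhds_zero_nat
      intro n m N hn hm
      have := hc2 (S (b N)) (b N).length (ν (b N)) _
        (hanti (Nat.succ_le_succ hn) (hp (n + 1))) _ (hanti (Nat.succ_le_succ hm) (hp (m + 1)))
      rwa [hbl] at this
    obtain ⟨x, hx⟩ := cauchySeq_tendsto_of_complete hcau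
    have hxS : ∀ n, x ∈ (S (b n)).1 := by
      intro n
      apply hc1 (S (b n)) (b n).length (ν (b n))
      refine mem_closure_of_tendsto hx ?_
      filter_upwards [eventually_ge_atTop n] with m hm
      exact hanti (Nat.succ_le_succ hm) (hp (m + 1))
    have hxH : φ x ∈ ⋃ n, F n := hcov ⟨x, mem_iInter.2 fun n =>
      mem_biUnion (show b n ∈ {s : List ℕ | s.length = n} from hbl n) (hxS n), rfl⟩
    obtain ⟨n, hn⟩ := mem_iUnion.1 hxH
    have := hν (b n) x (hxS (n + 1))
    rw [hbl] at this
    exact this hn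

end helpers

lemma core_polish {X : Type*} [MetricSpace X] [CompactSpace X] [MeasurableSpace X] [BorelSpace X]
    {I : Set (Set X)} {P Z : Type*} [TopologicalSpace P] [PolishSpace P]
    [MetricSpace Z] [CompactSpace Z]
    (hI : Calibrated I) (h0 : ∅ ∈ I) {φ : P → X} {g : P → Z}
    (hφ : Continuous φ) (hg : Continuous g)
    (hpos : ¬ JCov I (range φ))
    (hfib : ∀ z, JCov I (φ '' (g ⁻¹' {z}))) :
    ∃ H : Set P, IsGδ H ∧ InjOn g H ∧ ¬ JCov I (φ '' H) := by
  letI := TopologicalSpace.upgradeIsCompletelyMetrizable P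
  let 𝒱 : Set (Set P) := {V | IsOpen V ∧ JCov I (φ '' V)}
  have hO : JCov I (φ '' ⋃₀ 𝒱) := by
    obtain ⟨T, hTc, hTs, hTe⟩ := TopologicalSpace.isOpen_sUnion_countable 𝒱 fun s hs => hs.1
    rw [← hTe]
    rcases T.eq_empty_or_nonempty with rfl | hne
    · exact ⟨fun _ => ∅, fun _ => ⟨isCompact_empty, h0⟩, by simp⟩
    · obtain ⟨e, rfl⟩ := hTc.exists_eq_range hne
      rw [sUnion_range, image_iUnion]
      exact JCov.iUnion fun n => (hTs ⟨n, rfl⟩).2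
  have hOo : IsOpen (⋃₀ 𝒱) := isOpen_sUnion fun s hs => hs.1
  let Q : Set P := (⋃₀ 𝒱)ᶜ
  have hQ : IsClosed Q := hOo.isClosed_compl
  have hQne : Nonempty Q := by
    by_contra hcon
    apply hpos
    refine hO.mono ?_
    rintro _ ⟨p, rfl⟩
    refine ⟨p, ?_, rfl⟩
    by_contra hp
    exact hcon ⟨⟨p, hp⟩⟩
  haveI : CompleteSpace Q := hQ.completeSpace_coe
  obtain ⟨H, hH, hinj, hHJ⟩ := core_s19 (P := Q) hI h0 (φ := fun q => φ q.1) (g := fun q => g q.1)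
    (by fun_prop) (by fun_prop) (by
      rintro V hV ⟨v, hv⟩ hJ
      obtain ⟨W, hW, rfl⟩ := isOpen_induced_iff.1 hV
      apply v.2
      refine ⟨W, ⟨hW, (hJ.union hO).mono ?_⟩, hv⟩
      rintro _ ⟨p, hp, rfl⟩
      by_cases hpQ : p ∈ ⋃₀ 𝒱
      · exact Or.inr ⟨p, hpQ, rfl⟩
      · exact Or.inl ⟨⟨p, hpQ⟩, hp, rfl⟩)
    (by
      intro z
      refine (hfib z).mono ?_
      rintro _ ⟨q, hq, rfl⟩
      exact ⟨q.1, hq, rfl⟩)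
  refine ⟨Subtype.val '' H, ?_, ?_, ?_⟩
  · obtain ⟨T, hTo, hTc, rfl⟩ := hH
    have : (Subtype.val '' ⋂₀ T : Set P) =
        Q ∩ ⋂ t ∈ T, (Subtype.val '' tᶜ)ᶜ := by
      ext p
      simp only [mem_image, mem_sInter, mem_inter_iff, mem_iInter, mem_compl_iff, Subtype.exists,
        exists_and_right, exists_eq_right, not_exists, not_not]
      constructor
      · rintro ⟨hp, h⟩
        exact ⟨hp, fun t ht _ => h t ht⟩
      · rintro ⟨hp, h⟩
        exact ⟨hp, fun t ht => h t ht hp⟩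
    rw [this]
    refine hQ.isGδ.inter (IsGδ.biInter hTc fun t ht => IsOpen.isGδ ?_)
    exact (hQ.isClosedEmbedding_subtypeVal.isClosedMap _ (hTo t ht).isClosed_compl).isOpen_compl
  · rintro _ ⟨p, hp, rfl⟩ _ ⟨q, hq, rfl⟩ hpq
    rw [hinj hp hq hpq]
  · rwa [image_image]

/-- Theorem 7.0 (the "1-1 or constant" property of Sabok–Zapletal, Section 7.2): for any
calibrated σ-ideal `I` on a compactum `X`, any Borel map `f : B → ℕ^ℕ` on a Borel set
`B ∉ I` with all fibers in `I` is injective on some Borel set `C ⊆ B` with `C ∉ I`. -/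
theorem statement19 {X : Type*}
    [MetricSpace X] [CompactSpace X] [Nonempty X] [MeasurableSpace X] [BorelSpace X]
    (I : Set (Set X)) (hI : Calibrated I)
    (B : Set X) (hB : MeasurableSet B) (hBI : B ∉ I)
    (f : X → (ℕ → ℕ)) (hf : Measurable fun x : B => f x.1)
    (hfib : ∀ y : ℕ → ℕ, {x ∈ B | f x = y} ∈ I) :
    ∃ C ⊆ B, MeasurableSet C ∧ C ∉ I ∧ Set.InjOn f C := by
  have h0 : ∅ ∈ I := hI.1.2.1 _ (hfib 0) ∅ MeasurableSet.empty (empty_subset _)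
  let e : (ℕ → ℕ) → unitInterval := unitInterval.sigmoid ∘ embeddingReal (ℕ → ℕ)
  have he : MeasurableEmbedding e := measurableEmbedding_sigmoid_comp_embeddingReal (ℕ → ℕ)
  haveI : StandardBorelSpace B := hB.standardBorel
  have hm : Measurable fun x : B => ((x : X), e (f x.1)) :=
    measurable_subtype_coe.prodMk (he.measurable.comp hf)
  have han : AnalyticSet ((fun x : B => ((x : X), e (f x.1))) '' univ) :=
    MeasurableSet.univ.analyticSet_image hm
  rw [image_univ, analyticSet_iff_exists_polishSpace_range] at han
  obtain ⟨P, tP, hP, ψ, hψ, hψr⟩ := han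
  have hψB : ∀ p, (ψ p).1 ∈ B ∧ (ψ p).2 = e (f (ψ p).1) := by
    intro p
    obtain ⟨x, hx⟩ : ψ p ∈ range fun x : B => ((x : X), e (f x.1)) := hψr ▸ mem_range_self p
    rw [← hx]
    exact ⟨x.2, rfl⟩
  have hBψ : ∀ x ∈ B, ∃ p, (ψ p).1 = x := by
    intro x hx
    obtain ⟨p, hp⟩ : (x, e (f x)) ∈ range ψ := hψr ▸ ⟨⟨x, hx⟩, rfl⟩
    exact ⟨p, by rw [hp]⟩
  obtain ⟨H, hH, hinj, hHJ⟩ := core_polish hI h0 (φ := fun p => (ψ p).1) (g := fun p => (ψ p).2)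
    (by fun_prop) (by fun_prop)
    (by
      intro hJ
      exact hBI ((hJ.mono fun x hx => hBψ x hx).mem hI hB))
    (by
      intro z
      by_cases hz : ∃ y, e y = z
      · obtain ⟨y, rfl⟩ := hz
        refine (JCov.of_mem hI (hfib y)).mono ?_
        rintro _ ⟨p, hp, rfl⟩
        refine ⟨(hψB p).1, he.injective ?_⟩
        rw [← (hψB p).2]
        exact hp
      · refine ⟨fun _ => ∅, fun _ => ⟨isCompact_empty, h0⟩, ?_⟩
        rintro _ ⟨p, hp, rfl⟩
        exact absurd ⟨_, (hψB p).2.symm.trans hp⟩ hz)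
  have hinjf : ∀ p ∈ H, ∀ q ∈ H, f (ψ p).1 = f (ψ q).1 → p = q := by
    intro p hp q hq hpq
    apply hinj hp hq
    simp only [(hψB p).2, (hψB q).2, hpq]
  refine ⟨(fun p => (ψ p).1) '' H, ?_, ?_, ?_, ?_⟩
  · rintro _ ⟨p, _, rfl⟩
    exact (hψB p).1
  · letI : MeasurableSpace P := borel P
    haveI : BorelSpace P := ⟨rfl⟩
    refine hH.measurableSet.image_of_continuousOn_injOn (by fun_prop) ?_
    intro p hp q hq hpq
    exact hinjf p hp q hq (congrArg f hpq)
  · exact fun hmem => hHJ (JCov.of_mem hI hmem)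
  · rintro _ ⟨p, hp, rfl⟩ _ ⟨q, hq, rfl⟩ hpq
    rw [hinjf p hp q hq hpq]
end
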